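/- arXiv:1912.12561 — 2 statements merged into one kernel-verified Lean document; each statement's English description precedes it below -/
import Mathlib

section
/- Let N ≥ 1, let U be a random matrix drawn from the Haar (uniform) probability measure on the orthogonal group O(N), let S, T ⊆ [N] be fixed nonempty sets, and let t > 0. Then Pr[ ‖U_{S,T}‖ ≥ 2t/√N ] ≤ 2·9^{|S|+|T|}·e^{-t²/8}, where U_{S,T} is the submatrix of U with rows indexed by S and columns indexed by T and ‖·‖ is the operator (spectral) norm. -/
open scoped BigOperators
open MeasureTheory

/-- `U : Fin N → Fin N → ℝ` (viewed as an `N × N` real matrix `U i j`) is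
orthogonal: its columns and its rows are orthonormal. -/
def IsOrthogonal {N : ℕ} (U : Fin N → Fin N → ℝ) : Prop :=
  (∀ j₁ j₂ : Fin N, ∑ i, U i j₁ * U i j₂ = if j₁ = j₂ then (1 : ℝ) else 0) ∧
  (∀ i₁ i₂ : Fin N, ∑ j, U i₁ j * U i₂ j = if i₁ = i₂ then (1 : ℝ) else 0)

/-- The operator (spectral) norm of a real matrix `A` (given as a function):
`‖A‖ = sup_{x ≠ 0} ‖Ax‖₂ / ‖x‖₂` (and `0` if the index types are empty). -/
noncomputable def opNorm {m n : Type} [Fintype m] [Fintype n]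
    (A : m → n → ℝ) : ℝ :=
  sSup {r : ℝ | ∃ x : n → ℝ, x ≠ 0 ∧
    r = Real.sqrt (∑ i, (∑ j, A i j * x j) ^ 2) / Real.sqrt (∑ j, x j ^ 2)}

/-- The operator norm of the submatrix `U_{S,T}` of `U` with rows indexed by
`S` and columns indexed by `T`. -/
noncomputable def subOpNorm {N : ℕ} (U : Fin N → Fin N → ℝ)
    (S T : Finset (Fin N)) : ℝ :=
  opNorm (fun (i : {a // a ∈ S}) (j : {a // a ∈ T}) => U i.val j.val)

namespace HaarAux

/-- Householder reflection. -/
noncomputable def house {N : ℕ} (u : Fin N → ℝ) : Fin N → Fin N → ℝ :=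
  fun i j => (if i = j then (1 : ℝ) else 0) - 2 / (∑ l, u l ^ 2) * (u i * u j)

theorem house_orth_aux {N : ℕ} (u : Fin N → ℝ) (i j : Fin N) :
    ∑ l, house u i l * house u j l = if i = j then (1 : ℝ) else 0 := by
  set q := ∑ l, u l ^ 2 with hq
  have h1 : ∀ l, house u i l * house u j l =
      (if i = l then (if j = l then (1 : ℝ) else 0) else 0)
      - (if i = l then 2 / q * (u j * u l) else 0)
      - (if j = l then 2 / q * (u i * u l) else 0)
      + (2 / q) ^ 2 * (u i * u j) * u l ^ 2 := by
    intro l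
    unfold house
    split_ifs <;> ring
  simp_rw [h1]
  rw [Finset.sum_add_distrib, Finset.sum_sub_distrib, Finset.sum_sub_distrib, ← Finset.mul_sum,
    ← hq]
  simp only [Finset.sum_ite_eq, Finset.mem_univ, if_true]
  have h2 : (2 / q) ^ 2 * (u i * u j) * q = 2 * (2 / q * (u i * u j)) := by
    by_cases h : q = 0
    · simp [h]
    · field_simp
  rw [h2]
  simp only [eq_comm (a := j) (b := i)]
  ring

theorem house_symm {N : ℕ} (u : Fin N → ℝ) (i j : Fin N) : house u i j = house u j i := by
  unfold house
  simp only [eq_comm (a := j) (b := i)]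
  ring

theorem house_orth {N : ℕ} (u : Fin N → ℝ) : IsOrthogonal (house u) := by
  refine ⟨fun i j => ?_, house_orth_aux u⟩
  rw [← house_orth_aux u i j]
  exact Finset.sum_congr rfl fun l _ => by rw [house_symm u l i, house_symm u l j]

theorem house_map {N : ℕ} (x w : Fin N → ℝ) (h : ∑ i, x i ^ 2 = ∑ i, w i ^ 2) (j : Fin N) :
    ∑ i, x i * house (fun k => x k - w k) i j = w j := by
  set q := ∑ l, (x l - w l) ^ 2 with hq
  have h1 : ∀ i, x i * house (fun k => x k - w k) i j =
      (if i = j then x i else 0) - 2 / q * (x j - w j) * (x i * (x i - w i)) := by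
    intro i
    unfold house
    split_ifs <;> ring
  simp_rw [h1]
  rw [Finset.sum_sub_distrib, ← Finset.mul_sum]
  simp only [Finset.sum_ite_eq', Finset.mem_univ, if_true]
  have h3 : 2 * ∑ i, x i * (x i - w i) = q := by
    have : q = ∑ i, (2 * (x i * (x i - w i)) + (w i ^ 2 - x i ^ 2)) :=
      Finset.sum_congr rfl fun i _ => by ring
    rw [this, Finset.sum_add_distrib, Finset.sum_sub_distrib, h, Finset.mul_sum]
    ring
  by_cases h0 : q = 0
  · have : x j - w j = 0 := by
      have := (Finset.sum_eq_zero_iff_of_nonneg (fun i _ => sq_nonneg (x i - w i))).1 h0 j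
        (Finset.mem_univ j)
      exact pow_eq_zero_iff (two_ne_zero) |>.1 this
    rw [this]
    linarith
  · have : 2 / q * (x j - w j) * ∑ i, x i * (x i - w i) = x j - w j := by
      have : ∑ i, x i * (x i - w i) = q / 2 := by linarith
      rw [this]
      field_simp
    rw [this]; ring

theorem orth_norm {N : ℕ} (U : Fin N → Fin N → ℝ) (hU : IsOrthogonal U) (y : Fin N → ℝ) :
    ∑ i, (∑ j, U i j * y j) ^ 2 = ∑ j, y j ^ 2 := by
  calc ∑ i, (∑ j, U i j * y j) ^ 2
      = ∑ i, ∑ j, ∑ k, (y j * y k) * (U i j * U i k) := by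
        refine Finset.sum_congr rfl fun i _ => ?_
        rw [sq, Finset.sum_mul_sum]
        exact Finset.sum_congr rfl fun j _ => Finset.sum_congr rfl fun k _ => by ring
    _ = ∑ j, ∑ k, (y j * y k) * ∑ i, U i j * U i k := by
        rw [Finset.sum_comm]
        refine Finset.sum_congr rfl fun j _ => ?_
        rw [Finset.sum_comm]
        exact Finset.sum_congr rfl fun k _ => by rw [Finset.mul_sum]
    _ = ∑ j, y j ^ 2 := by
        refine Finset.sum_congr rfl fun j _ => ?_
        simp [hU.1, sq]

/-- exponential moment -/
noncomputable def mom {N : ℕ} (μ : Measure (Fin N → Fin N → ℝ)) (y x : Fin N → ℝ) : ENNReal :=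
  ∫⁻ U, ENNReal.ofReal (Real.exp (∑ i, x i * ∑ j, U i j * y j)) ∂μ

theorem mom_meas {N : ℕ} (y x : Fin N → ℝ) : Measurable (fun U : Fin N → Fin N → ℝ =>
    ENNReal.ofReal (Real.exp (∑ i, x i * ∑ j, U i j * y j))) := by
  fun_prop

theorem mom_eq {N : ℕ} (μ : Measure (Fin N → Fin N → ℝ))
    (hinv : ∀ V : Fin N → Fin N → ℝ, IsOrthogonal V →
      μ.map (fun U => fun i j => ∑ l, V i l * U l j) = μ)
    (y x w : Fin N → ℝ) (h : ∑ i, x i ^ 2 = ∑ i, w i ^ 2) : mom μ y x = mom μ y w := by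
  set V := house (fun k => x k - w k) with hV
  unfold mom
  conv_lhs => rw [← hinv V (house_orth _)]
  rw [lintegral_map (mom_meas y x) (by fun_prop)]
  refine lintegral_congr fun U => ?_
  congr 2
  calc ∑ i, x i * ∑ j, (∑ l, V i l * U l j) * y j
      = ∑ i, ∑ l, (x i * V i l) * ∑ j, U l j * y j := by
        refine Finset.sum_congr rfl fun i _ => ?_
        simp_rw [Finset.sum_mul, Finset.mul_sum]
        rw [Finset.sum_comm]
        exact Finset.sum_congr rfl fun j _ => Finset.sum_congr rfl fun k _ => by ring
    _ = ∑ l, (∑ i, x i * V i l) * ∑ j, U l j * y j := by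
        rw [Finset.sum_comm]
        exact Finset.sum_congr rfl fun j _ => by rw [Finset.sum_mul]
    _ = _ := by
        refine Finset.sum_congr rfl fun i _ => ?_
        rw [hV, house_map x w h]

/-- sign of a boolean -/
def sgn (b : Bool) : ℝ := if b then 1 else -1

theorem sum_signs {N : ℕ} (l : ℝ) (v : Fin N → ℝ) (hv : ∑ i, v i ^ 2 = 1) :
    ∑ e : Fin N → Bool, Real.exp (∑ i, (l * sgn (e i)) * v i) ≤ 2 ^ N * Real.exp (l ^ 2 / 2) := by
  have h := Finset.prod_univ_sum (fun _ : Fin N => (Finset.univ : Finset Bool))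
    (fun i b => Real.exp ((l * sgn b) * v i))
  simp only [Fintype.piFinset_univ] at h
  simp_rw [Real.exp_sum]
  rw [← h]
  calc ∏ i, ∑ b : Bool, Real.exp ((l * sgn b) * v i)
      ≤ ∏ i, (2 * Real.exp ((l * v i) ^ 2 / 2)) := by
        refine Finset.prod_le_prod (fun i _ => Finset.sum_nonneg fun b _ => (Real.exp_pos _).le)
          fun i _ => ?_
        have := Real.cosh_le_exp_half_sq (l * v i)
        rw [Real.cosh_eq] at this
        simp [sgn]
        linarith
    _ = 2 ^ N * Real.exp (l ^ 2 / 2) := by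
        rw [Finset.prod_mul_distrib, ← Real.exp_sum]
        simp only [Finset.prod_const, Finset.card_univ, Fintype.card_fin]
        congr 2
        calc ∑ i, (l * v i) ^ 2 / 2 = (l ^ 2 / 2) * ∑ i, v i ^ 2 := by
              rw [Finset.mul_sum]; exact Finset.sum_congr rfl fun i _ => by ring
          _ = _ := by rw [hv, mul_one]

theorem mom_le {N : ℕ} (μ : Measure (Fin N → Fin N → ℝ)) [IsProbabilityMeasure μ]
    (horth : ∀ᵐ U ∂μ, IsOrthogonal U)
    (hinv : ∀ V : Fin N → Fin N → ℝ, IsOrthogonal V →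
      μ.map (fun U => fun i j => ∑ l, V i l * U l j) = μ)
    (y x : Fin N → ℝ) (l : ℝ) (hy : ∑ i, y i ^ 2 = 1) (hx : ∑ i, x i ^ 2 = N * l ^ 2) :
    mom μ y x ≤ ENNReal.ofReal (Real.exp (l ^ 2 / 2)) := by
  have h1 : ∀ e : Fin N → Bool, mom μ y (fun i => l * sgn (e i)) = mom μ y x := by
    intro e
    apply mom_eq μ hinv
    rw [hx]
    have : ∀ i, (l * sgn (e i)) ^ 2 = l ^ 2 := by
      intro i; unfold sgn; split_ifs <;> ring
    simp [this]
  have h2 : (2 : ENNReal) ^ N * mom μ y x = ∑ e : Fin N → Bool, mom μ y (fun i => l * sgn (e i)) := by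
    simp [h1]
  have h3 : (2 : ENNReal) ^ N * mom μ y x ≤ 2 ^ N * ENNReal.ofReal (Real.exp (l ^ 2 / 2)) := by
    rw [h2]
    unfold mom
    rw [← lintegral_finsetSum _ (fun e _ => mom_meas _ _)]
    calc _ ≤ ∫⁻ U, 2 ^ N * ENNReal.ofReal (Real.exp (l ^ 2 / 2)) ∂μ := by
          refine lintegral_mono_ae ?_
          filter_upwards [horth] with U hU
          rw [← ENNReal.ofReal_sum_of_nonneg (fun e _ => (Real.exp_pos _).le)]
          refine (ENNReal.ofReal_le_ofReal (sum_signs l _ ((orth_norm U hU y).trans hy))).trans ?_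
          rw [ENNReal.ofReal_mul (by positivity), ENNReal.ofReal_pow (by norm_num)]
          simp
      _ = _ := by simp
  exact (ENNReal.mul_le_mul_iff_right (by simp) (by simp)).1 h3

theorem tail {N : ℕ} (hN : 1 ≤ N) (μ : Measure (Fin N → Fin N → ℝ)) [IsProbabilityMeasure μ]
    (horth : ∀ᵐ U ∂μ, IsOrthogonal U)
    (hinv : ∀ V : Fin N → Fin N → ℝ, IsOrthogonal V →
      μ.map (fun U => fun i j => ∑ l, V i l * U l j) = μ)
    (y x : Fin N → ℝ) (s : ℝ) (hs : 0 < s) (hy : ∑ i, y i ^ 2 = 1) (hx : ∑ i, x i ^ 2 = 1) :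
    μ {U | s / Real.sqrt N ≤ ∑ i, x i * ∑ j, U i j * y j} ≤
      ENNReal.ofReal (Real.exp (-s ^ 2 / 2)) := by
  have hN' : (0 : ℝ) < N := by exact_mod_cast hN
  have hq : 0 < Real.sqrt N := Real.sqrt_pos.2 hN'
  have h := mom_le μ horth hinv y (fun i => (s * Real.sqrt N) * x i) s hy (by
    simp_rw [mul_pow]
    rw [← Finset.mul_sum, hx, Real.sq_sqrt hN'.le]; ring)
  have h2 := mul_meas_ge_le_lintegral (μ := μ) (mom_meas y (fun i => (s * Real.sqrt N) * x i))
    (ENNReal.ofReal (Real.exp (s ^ 2)))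
  have hsub : {U : Fin N → Fin N → ℝ | s / Real.sqrt N ≤ ∑ i, x i * ∑ j, U i j * y j} ⊆
      {U | ENNReal.ofReal (Real.exp (s ^ 2)) ≤ ENNReal.ofReal
        (Real.exp (∑ i, ((s * Real.sqrt N) * x i) * ∑ j, U i j * y j))} := by
    intro U hU
    apply ENNReal.ofReal_le_ofReal
    apply Real.exp_le_exp.2
    simp_rw [mul_assoc (s * Real.sqrt N)]
    rw [← Finset.mul_sum]
    have hU' : s / Real.sqrt N ≤ ∑ i, x i * ∑ j, U i j * y j := hU
    rw [div_le_iff₀ hq] at hU'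
    nlinarith
  have h3 : ENNReal.ofReal (Real.exp (s ^ 2)) *
      μ {U | s / Real.sqrt N ≤ ∑ i, x i * ∑ j, U i j * y j} ≤
      ENNReal.ofReal (Real.exp (s ^ 2)) * ENNReal.ofReal (Real.exp (-s ^ 2 / 2)) := by
    refine (mul_le_mul_right (measure_mono hsub) _).trans (h2.trans (h.trans ?_))
    rw [← ENNReal.ofReal_mul (Real.exp_pos _).le, ← Real.exp_add]
    apply ENNReal.ofReal_le_ofReal
    apply Real.exp_le_exp.2
    linarith
  exact (ENNReal.mul_le_mul_iff_right (by simp [Real.exp_pos]) (by simp)).1 h3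

theorem exists_net (ι : Type) [Fintype ι] :
    ∃ P : Finset (EuclideanSpace ℝ ι), (∀ p ∈ P, ‖p‖ = 1) ∧ P.card ≤ 5 ^ Fintype.card ι ∧
      ∀ x : EuclideanSpace ℝ ι, ‖x‖ = 1 → ∃ p ∈ P, ‖x - p‖ ≤ 1 / 2 := by
  classical
  have bound : ∀ P : Finset (EuclideanSpace ℝ ι), (∀ p ∈ P, ‖p‖ = 1) →
      (∀ p ∈ P, ∀ q ∈ P, p ≠ q → 1 / 2 ≤ ‖p - q‖) → P.card ≤ 5 ^ Fintype.card ι := by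
    intro P h1 h2
    have hinj : Function.Injective (fun p : EuclideanSpace ℝ ι => (2 : ℝ) • p) :=
      smul_right_injective _ (two_ne_zero)
    have := Besicovitch.card_le_of_separated (P.image (fun p => (2 : ℝ) • p)) (by
      intro c hc
      obtain ⟨p, hp, rfl⟩ := Finset.mem_image.1 hc
      simp [norm_smul, h1 p hp]) (by
      intro c hc d hd hcd
      obtain ⟨p, hp, rfl⟩ := Finset.mem_image.1 hc
      obtain ⟨q, hq, rfl⟩ := Finset.mem_image.1 hd
      have := h2 p hp q hq (fun h => hcd (by rw [h]))
      rw [← smul_sub, norm_smul]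
      norm_num at this ⊢
      linarith)
    rw [Finset.card_image_of_injective _ hinj] at this
    simpa using this
  by_contra hcon
  have key : ∀ k : ℕ, ∃ P : Finset (EuclideanSpace ℝ ι), (∀ p ∈ P, ‖p‖ = 1) ∧
      (∀ p ∈ P, ∀ q ∈ P, p ≠ q → 1 / 2 ≤ ‖p - q‖) ∧ P.card = k := by
    intro k
    induction k with
    | zero => exact ⟨∅, by simp⟩
    | succ k ih =>
      obtain ⟨P, h1, h2, h3⟩ := ih
      have : ¬ ∀ x : EuclideanSpace ℝ ι, ‖x‖ = 1 → ∃ p ∈ P, ‖x - p‖ ≤ 1 / 2 :=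
        fun h => hcon ⟨P, h1, bound P h1 h2, h⟩
      push Not at this
      obtain ⟨x, hx, hxP⟩ := this
      refine ⟨insert x P, ?_, ?_, ?_⟩
      · intro p hp
        rcases Finset.mem_insert.1 hp with rfl | hp
        · exact hx
        · exact h1 p hp
      · intro p hp q hq hpq
        rcases Finset.mem_insert.1 hp with rfl | hp'
        · rcases Finset.mem_insert.1 hq with rfl | hq
          · exact absurd rfl hpq
          · exact (hxP q hq).le
        · rcases Finset.mem_insert.1 hq with rfl | hq
          · rw [norm_sub_rev]; exact (hxP p (by assumption)).le
          · exact h2 p hp' q hq hpq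
      · rw [Finset.card_insert_of_notMem, h3]
        intro hx'
        have := hxP x hx'
        simp at this
        norm_num at this
  obtain ⟨P, h1, h2, h3⟩ := key (5 ^ Fintype.card ι + 1)
  have := bound P h1 h2
  omega

theorem norm_le_net {E : Type*} [NormedAddCommGroup E] [InnerProductSpace ℝ E]
    (P : Finset E) (hP : ∀ x : E, ‖x‖ = 1 → ∃ p ∈ P, ‖x - p‖ ≤ 1 / 2)
    (m : ℝ) (hm : 0 ≤ m) (z : E) (h : ∀ p ∈ P, inner ℝ p z ≤ m) : ‖z‖ ≤ 2 * m := by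
  by_cases hz : z = 0
  · simp [hz]; exact hm
  have hz' : 0 < ‖z‖ := norm_pos_iff.2 hz
  obtain ⟨p, hp, hpz⟩ := hP (‖z‖⁻¹ • z) (by rw [norm_smul]; simp [hz'.ne'])
  have h1 : inner ℝ (‖z‖⁻¹ • z) z = ‖z‖ := by
    rw [real_inner_smul_left, real_inner_self_eq_norm_sq]; field_simp
  have h2 := real_inner_le_norm (‖z‖⁻¹ • z - p) z
  rw [inner_sub_left, h1] at h2
  have h3 := h p hp
  nlinarith

theorem opnorm_le_net {E F : Type*} [NormedAddCommGroup E] [InnerProductSpace ℝ E]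
    [NormedAddCommGroup F] [InnerProductSpace ℝ F] (A : E →L[ℝ] F)
    (P : Finset E) (hP : ∀ x : E, ‖x‖ = 1 → ∃ p ∈ P, ‖x - p‖ ≤ 1 / 2)
    (m : ℝ) (hm : 0 ≤ m) (h : ∀ p ∈ P, ‖A p‖ ≤ m) : ‖A‖ ≤ 2 * m := by
  have : ‖A‖ ≤ m + ‖A‖ / 2 := by
    refine ContinuousLinearMap.opNorm_le_of_unit_norm (by positivity) fun x hx => ?_
    obtain ⟨p, hp, hpx⟩ := hP x hx
    have h1 : A x = A p + A (x - p) := by simp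
    rw [h1]
    refine (norm_add_le _ _).trans ?_
    have h2 := A.le_opNorm (x - p)
    have h3 := h p hp
    nlinarith [norm_nonneg A]
  linarith

/-- the matrix as a linear map -/
noncomputable def toL {m n : Type} [Fintype m] [Fintype n] (A : m → n → ℝ) :
    EuclideanSpace ℝ n →ₗ[ℝ] EuclideanSpace ℝ m where
  toFun x := WithLp.toLp 2 (fun i => ∑ j, A i j * x j)
  map_add' x y := by
    ext i
    simp [mul_add, Finset.sum_add_distrib]
  map_smul' c x := by
    ext i
    simp [Finset.mul_sum, mul_left_comm]

theorem opNorm_le {m n : Type} [Fintype m] [Fintype n] (A : m → n → ℝ) (c : ℝ) (hc : 0 ≤ c)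
    (P : Finset (EuclideanSpace ℝ m)) (Q : Finset (EuclideanSpace ℝ n))
    (hP : ∀ x : EuclideanSpace ℝ m, ‖x‖ = 1 → ∃ p ∈ P, ‖x - p‖ ≤ 1 / 2)
    (hQ : ∀ x : EuclideanSpace ℝ n, ‖x‖ = 1 → ∃ p ∈ Q, ‖x - p‖ ≤ 1 / 2)
    (h : ∀ p ∈ P, ∀ q ∈ Q, ∑ i, p i * ∑ j, A i j * q j ≤ c) : opNorm A ≤ 4 * c := by
  have h1 : ‖(toL A).toContinuousLinearMap‖ ≤ 2 * (2 * c) := by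
    refine opnorm_le_net _ Q hQ (2 * c) (by positivity) fun q hq => ?_
    refine norm_le_net P hP c hc _ fun p hp => ?_
    refine le_trans (le_of_eq ?_) (h p hp q hq)
    simp [PiLp.inner_apply, toL, mul_comm]
  refine Real.sSup_le ?_ (by positivity)
  rintro r ⟨x, hx, rfl⟩
  have h2 := (toL A).toContinuousLinearMap.le_of_opNorm_le h1 (WithLp.toLp 2 x)
  simp only [EuclideanSpace.norm_eq, toL, Real.norm_eq_abs, sq_abs] at h2
  refine div_le_of_le_mul₀ (Real.sqrt_nonneg _) (by positivity) ?_
  refine le_trans (le_of_eq ?_) (h2.trans (le_of_eq ?_))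
  · rfl
  · ring_nf

/-- extension by zero -/
noncomputable def ext0 {N : ℕ} {S : Finset (Fin N)} (p : EuclideanSpace ℝ {a // a ∈ S}) :
    Fin N → ℝ := fun i => if h : i ∈ S then p ⟨i, h⟩ else 0

theorem sum_ext0 {N : ℕ} {S : Finset (Fin N)} (p : EuclideanSpace ℝ {a // a ∈ S})
    (f : Fin N → ℝ → ℝ) (hf : ∀ i, f i 0 = 0) :
    ∑ i, f i (ext0 p i) = ∑ i : {a // a ∈ S}, f i (p i) := by
  rw [← Finset.sum_subset (Finset.subset_univ S), ← Finset.sum_coe_sort S]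
  · exact Finset.sum_congr rfl fun i _ => by simp [ext0]
  · intro i _ hi
    simp [ext0, hi, hf]

theorem ext0_norm {N : ℕ} {S : Finset (Fin N)} (p : EuclideanSpace ℝ {a // a ∈ S})
    (hp : ‖p‖ = 1) : ∑ i, ext0 p i ^ 2 = 1 := by
  rw [sum_ext0 p (fun _ r => r ^ 2) (by simp)]
  have := EuclideanSpace.real_norm_sq_eq p
  rw [← this, hp]; norm_num

end HaarAux

open HaarAux in
theorem haar_submatrix_norm_tail_bound (N : ℕ) (hN : 1 ≤ N)
    (μ : Measure (Fin N → Fin N → ℝ)) (hprob : IsProbabilityMeasure μ)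
    (horth : ∀ᵐ U ∂μ, IsOrthogonal U)
    (hinv : ∀ V : Fin N → Fin N → ℝ, IsOrthogonal V →
      μ.map (fun U => fun i j => ∑ l, V i l * U l j) = μ)
    (S T : Finset (Fin N)) (hS : S.Nonempty) (hT : T.Nonempty)
    (t : ℝ) (ht : 0 < t) :
    (μ {U | 2 * t / Real.sqrt N ≤ subOpNorm U S T}).toReal ≤
      2 * 9 ^ (S.card + T.card) * Real.exp (-t ^ 2 / 8) := by
  classical
  obtain ⟨P, hP1, hPc, hP⟩ := exists_net {a // a ∈ S}
  obtain ⟨Q, hQ1, hQc, hQ⟩ := exists_net {a // a ∈ T}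
  have hN' : (0 : ℝ) < N := by exact_mod_cast hN
  have hq : 0 < Real.sqrt N := Real.sqrt_pos.2 hN'
  let B : EuclideanSpace ℝ {a // a ∈ S} × EuclideanSpace ℝ {a // a ∈ T} →
    Set (Fin N → Fin N → ℝ) := fun z =>
      {U | (t / 2) / Real.sqrt N ≤ ∑ i, ext0 z.1 i * ∑ j, U i j * ext0 z.2 j}
  have hsub : {U | 2 * t / Real.sqrt N ≤ subOpNorm U S T} ⊆ ⋃ z ∈ P ×ˢ Q, B z := by
    intro U hU
    by_contra hcon
    have hlt : ∀ p ∈ P, ∀ q ∈ Q, ∑ i : {a // a ∈ S}, p i * ∑ j : {a // a ∈ T}, U i j * q j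
        < (t / 2) / Real.sqrt N := by
      intro p hp q hq'
      by_contra hge
      apply hcon
      refine Set.mem_biUnion (x := (p, q)) (by simp [hp, hq']) ?_
      have e1 : ∀ i, ∑ j, U i j * ext0 q j = ∑ j : {a // a ∈ T}, U i j * q j := fun i =>
        sum_ext0 q (fun j r => U i j * r) (by simp)
      have e2 := sum_ext0 p (fun i r => r * ∑ j : {a // a ∈ T}, U i j * q j) (by simp)
      change (t / 2) / Real.sqrt N ≤ ∑ i, ext0 p i * ∑ j, U i j * ext0 q j
      simp_rw [e1]
      rw [e2]
      exact not_lt.1 hge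
    have : ∃ c, 0 ≤ c ∧ c < (t / 2) / Real.sqrt N ∧ ∀ p ∈ P, ∀ q ∈ Q,
        ∑ i : {a // a ∈ S}, p i * ∑ j : {a // a ∈ T}, U i j * q j ≤ c := by
      have hpos : 0 < (t / 2) / Real.sqrt N := by positivity
      by_cases hne : (P ×ˢ Q).Nonempty
      · obtain ⟨z, hz, hmax⟩ := Finset.exists_max_image (P ×ˢ Q) (fun z =>
          ∑ i : {a // a ∈ S}, z.1 i * ∑ j : {a // a ∈ T}, U i j * z.2 j) hne
        rw [Finset.mem_product] at hz
        refine ⟨max 0 _, le_max_left _ _, max_lt hpos (hlt z.1 hz.1 z.2 hz.2), ?_⟩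
        intro p hp q hq'
        exact (hmax (p, q) (by simp [hp, hq'])).trans (le_max_right _ _)
      · refine ⟨0, le_rfl, hpos, ?_⟩
        intro p hp q hq'
        exact absurd ⟨(p, q), by simp [hp, hq']⟩ hne
    obtain ⟨c, hc0, hc, hcall⟩ := this
    have h1 : subOpNorm U S T ≤ 4 * c := opNorm_le _ c hc0 P Q hP hQ hcall
    have hU' : 2 * t / Real.sqrt N ≤ subOpNorm U S T := hU
    have h4 : 2 * t / Real.sqrt N = 4 * ((t / 2) / Real.sqrt N) := by ring
    linarith
  have hB : ∀ z ∈ P ×ˢ Q, μ (B z) ≤ ENNReal.ofReal (Real.exp (-t ^ 2 / 8)) := by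
    intro z hz
    rw [Finset.mem_product] at hz
    have := tail hN μ horth hinv (ext0 z.2) (ext0 z.1) (t / 2) (by positivity)
      (ext0_norm _ (hQ1 _ hz.2)) (ext0_norm _ (hP1 _ hz.1))
    have e : -(t / 2) ^ 2 / 2 = -t ^ 2 / 8 := by ring
    rw [e] at this
    exact this
  have hfin : μ {U | 2 * t / Real.sqrt N ≤ subOpNorm U S T} ≤
      ENNReal.ofReal ((P.card * Q.card : ℕ) * Real.exp (-t ^ 2 / 8)) := by
    refine (measure_mono hsub).trans ((measure_biUnion_finset_le _ _).trans
      ((Finset.sum_le_sum hB).trans (le_of_eq ?_)))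
    rw [Finset.sum_const, Finset.card_product, nsmul_eq_mul, ENNReal.ofReal_mul (by positivity),
      ENNReal.ofReal_natCast]
  refine (ENNReal.toReal_le_of_le_ofReal (by positivity) hfin).trans ?_
  gcongr
  have h5 : P.card * Q.card ≤ 2 * 9 ^ (S.card + T.card) := by
    rw [Fintype.card_coe] at hPc hQc
    calc P.card * Q.card ≤ 5 ^ S.card * 5 ^ T.card := Nat.mul_le_mul hPc hQc
      _ = 5 ^ (S.card + T.card) := by rw [pow_add]
      _ ≤ 9 ^ (S.card + T.card) := Nat.pow_le_pow_left (by norm_num) _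
      _ ≤ _ := by omega
  exact_mod_cast h5
end

section
/- There exists a universal constant C > 0 such that for every N ≥ 2, if U is drawn from the Haar (uniform) probability measure on the orthogonal group O(N), then with probability at least 1 - C/N², the matrix U is good; that is, with probability at least 1 - C/N², every pair of nonempty sets S, T ⊆ [N] satisfies ‖U_{S,T}‖ < √(100·(|S|+|T|)·ln N / N). -/
open scoped BigOperators
open MeasureTheory

open Matrix in
lemma orth_sq {N : ℕ} {U : Fin N → Fin N → ℝ} (h : IsOrthogonal U) (x : Fin N → ℝ) :
    ∑ i, (∑ j, U i j * x j) ^ 2 = ∑ j, x j ^ 2 := by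
  have h1 : (Matrix.of U)ᵀ * (Matrix.of U) = 1 := by
    ext i j
    simp only [Matrix.mul_apply, Matrix.transpose_apply, Matrix.of_apply, Matrix.one_apply]
    exact h.1 i j
  have h2 : (Matrix.of U *ᵥ x) ⬝ᵥ (Matrix.of U *ᵥ x) = x ⬝ᵥ x := by
    rw [Matrix.dotProduct_mulVec, Matrix.vecMul_mulVec, h1, Matrix.vecMul_one]
  simpa [dotProduct, Matrix.mulVec, pow_two] using h2

/-- bilinear form -/
def QF {N : ℕ} (U : Fin N → Fin N → ℝ) (y x : Fin N → ℝ) : ℝ :=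
  ∑ i, y i * ∑ j, U i j * x j

lemma QF_le {N : ℕ} {U : Fin N → Fin N → ℝ} (h : IsOrthogonal U) (y x : Fin N → ℝ) :
    QF U y x ≤ √(∑ i, y i ^ 2) * √(∑ i, x i ^ 2) := by
  rw [← orth_sq h x]
  exact Real.sum_mul_le_sqrt_mul_sqrt _ _ _

lemma QF_meas {N : ℕ} (y x : Fin N → ℝ) : Measurable (fun U : Fin N → Fin N → ℝ => QF U y x) := by
  unfold QF
  fun_prop

lemma exists_householder {N : ℕ} (y z : Fin N → ℝ) (hyz : ∑ i, y i ^ 2 = ∑ i, z i ^ 2) :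
    ∃ V : Fin N → Fin N → ℝ, IsOrthogonal V ∧ ∀ l, ∑ i, y i * V i l = z l := by
  classical
  set w : Fin N → ℝ := fun i => y i - z i with hw
  set n : ℝ := ∑ i, w i ^ 2 with hn
  set c : ℝ := 2 / n with hc
  have hcn : c * c * n = 2 * c := by
    by_cases h0 : n = 0
    · simp [hc, h0]
    · rw [hc]; field_simp
  have hwy : ∑ i, y i * w i = n / 2 := by
    have : n = ∑ i, (2 * (y i * w i) + (z i ^ 2 - y i ^ 2)) := by
      rw [hn]; refine Finset.sum_congr rfl fun i _ => ?_
      simp only [hw]; ring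
    rw [Finset.sum_add_distrib, Finset.sum_sub_distrib, hyz, ← Finset.mul_sum] at this
    linarith
  have key : ∀ a b : Fin N, ∑ l, ((if a = l then (1:ℝ) else 0) - c * w a * w l) *
      ((if b = l then (1:ℝ) else 0) - c * w b * w l) = if a = b then 1 else 0 := by
    intro a b
    have : ∀ l, ((if a = l then (1:ℝ) else 0) - c * w a * w l) *
      ((if b = l then (1:ℝ) else 0) - c * w b * w l) =
      (if a = l then (if b = l then (1:ℝ) else 0) else 0) - (if a = l then c * w b * w l else 0)
       - (if b = l then c * w a * w l else 0) + c * c * (w a * w b) * (w l ^ 2) := by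
      intro l
      split_ifs <;> ring
    simp only [this, Finset.sum_add_distrib, Finset.sum_sub_distrib, ← Finset.mul_sum, ← hn]
    simp only [Finset.sum_ite_eq, Finset.mem_univ, if_true]
    have h3 : c * c * (w a * w b) * n = 2 * c * (w a * w b) := by rw [← hcn]; ring
    rw [h3]
    simp only [eq_comm (a := b)]
    ring
  refine ⟨fun i l => (if i = l then (1:ℝ) else 0) - c * w i * w l, ⟨?_, ?_⟩, ?_⟩
  · intro a b
    rw [← key a b]
    refine Finset.sum_congr rfl fun l _ => ?_
    simp only [eq_comm (a := l)]
    ring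
  · intro a b
    exact key a b
  · intro l
    have : ∀ i, y i * ((if i = l then (1:ℝ) else 0) - c * w i * w l) =
       (if i = l then y i else 0) - c * w l * (y i * w i) := by
      intro i; split_ifs <;> ring
    simp only [this, Finset.sum_sub_distrib, ← Finset.mul_sum, hwy]
    simp only [Finset.sum_ite_eq', Finset.mem_univ, if_true]
    by_cases h0 : n = 0
    · have : w l = 0 := by
        have := (Finset.sum_eq_zero_iff_of_nonneg (fun i _ => sq_nonneg (w i))).1 (hn ▸ h0) l
          (Finset.mem_univ l)
        simpa using this
      have h5 : y l - z l = 0 := this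
      rw [this]; linarith
    · have : c * w l * (n / 2) = w l := by rw [hc]; field_simp
      rw [this]; simp [hw]

lemma lint_eq {N : ℕ} (μ : Measure (Fin N → Fin N → ℝ))
    (hinv : ∀ V : Fin N → Fin N → ℝ, IsOrthogonal V →
            μ.map (fun U => fun i j => ∑ l, V i l * U l j) = μ)
    (x y z : Fin N → ℝ) (hyz : ∑ i, y i ^ 2 = ∑ i, z i ^ 2) :
    ∫⁻ U, ENNReal.ofReal (Real.exp (QF U y x)) ∂μ =
    ∫⁻ U, ENNReal.ofReal (Real.exp (QF U z x)) ∂μ := by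
  obtain ⟨V, hV, hVy⟩ := exists_householder y z hyz
  conv_lhs => rw [← hinv V hV]
  rw [lintegral_map]
  · refine lintegral_congr fun U => ?_
    congr 2
    unfold QF
    simp only [← hVy, Finset.sum_mul, Finset.mul_sum]
    calc _ = ∑ i, ∑ l, ∑ j, y i * (V i l * U l j * x j) :=
          Finset.sum_congr rfl fun i _ => Finset.sum_comm
      _ = ∑ l, ∑ i, ∑ j, y i * (V i l * U l j * x j) := Finset.sum_comm
      _ = _ := by
        refine Finset.sum_congr rfl fun l _ => ?_
        rw [Finset.sum_comm]
        refine Finset.sum_congr rfl fun i _ => Finset.sum_congr rfl fun j _ => by ring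
  · exact ENNReal.measurable_ofReal.comp (Real.measurable_exp.comp (QF_meas y x))
  · fun_prop

lemma sum_signs {N : ℕ} (k : ℝ) (v : Fin N → ℝ) :
    ∑ e : Fin N → Bool, Real.exp (∑ i, (k * (if e i then 1 else -1)) * v i) ≤
      2 ^ N * Real.exp (k ^ 2 * (∑ i, v i ^ 2) / 2) := by
  have h1 : ∑ e : Fin N → Bool, Real.exp (∑ i, (k * (if e i then 1 else -1)) * v i) =
      ∏ i, ∑ b : Bool, Real.exp ((k * (if b then 1 else -1)) * v i) := by
    rw [Fintype.prod_sum]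
    simp only [Real.exp_sum]
  rw [h1]
  have h2 : ∀ i, ∑ b : Bool, Real.exp ((k * (if b then 1 else -1)) * v i) ≤
      2 * Real.exp (k ^ 2 * v i ^ 2 / 2) := by
    intro i
    have := Real.cosh_le_exp_half_sq (k * v i)
    rw [Real.cosh_eq] at this
    rw [mul_pow] at this
    simp
    linarith
  calc _ ≤ ∏ i, (2 * Real.exp (k ^ 2 * v i ^ 2 / 2)) :=
        Finset.prod_le_prod (fun i _ => by positivity) (fun i _ => h2 i)
    _ = _ := by
        rw [Finset.prod_mul_distrib, ← Real.exp_sum, Finset.mul_sum, Finset.sum_div]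
        simp

lemma mgf_bound {N : ℕ} (hN : 2 ≤ N) (μ : Measure (Fin N → Fin N → ℝ)) [IsProbabilityMeasure μ]
    (horth : ∀ᵐ U ∂μ, IsOrthogonal U)
    (hinv : ∀ V : Fin N → Fin N → ℝ, IsOrthogonal V →
            μ.map (fun U => fun i j => ∑ l, V i l * U l j) = μ)
    (x y : Fin N → ℝ) :
    ∫⁻ U, ENNReal.ofReal (Real.exp (QF U y x)) ∂μ ≤
      ENNReal.ofReal (Real.exp ((∑ i, y i ^ 2) * (∑ i, x i ^ 2) / (2 * N))) := by
  have hN0 : (N : ℝ) ≠ 0 := by positivity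
  set k : ℝ := √((∑ i, y i ^ 2) / N) with hk
  have hk2 : k ^ 2 = (∑ i, y i ^ 2) / N := Real.sq_sqrt (by positivity)
  have hz : ∀ e : Fin N → Bool, ∑ i, y i ^ 2 = ∑ i, (k * (if e i then 1 else -1)) ^ 2 := by
    intro e
    have : ∀ i, (k * (if e i then 1 else -1)) ^ 2 = k ^ 2 := by
      intro i; split_ifs <;> ring
    simp only [this]
    rw [hk2]
    simp
    field_simp
  have h1 : ∑ e : Fin N → Bool, ∫⁻ U, ENNReal.ofReal (Real.exp (QF U y x)) ∂μ ≤
      ENNReal.ofReal (2 ^ N * Real.exp ((∑ i, y i ^ 2) * (∑ i, x i ^ 2) / (2 * N))) := by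
    calc _ = ∑ e : Fin N → Bool, ∫⁻ U, ENNReal.ofReal (Real.exp
            (QF U (fun i => k * (if e i then 1 else -1)) x)) ∂μ :=
          Finset.sum_congr rfl fun e _ => lint_eq μ hinv x y _ (hz e)
      _ = ∫⁻ U, ∑ e : Fin N → Bool, ENNReal.ofReal (Real.exp
            (QF U (fun i => k * (if e i then 1 else -1)) x)) ∂μ := by
          rw [lintegral_finsetSum]
          intro e _
          exact ENNReal.measurable_ofReal.comp (Real.measurable_exp.comp (QF_meas _ x))
      _ ≤ ∫⁻ U, ENNReal.ofReal (2 ^ N * Real.exp ((∑ i, y i ^ 2) * (∑ i, x i ^ 2) / (2 * N))) ∂μ := by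
          refine lintegral_mono_ae ?_
          filter_upwards [horth] with U hU
          rw [← ENNReal.ofReal_sum_of_nonneg (fun _ _ => by positivity)]
          refine ENNReal.ofReal_le_ofReal ?_
          refine (sum_signs k (fun i => ∑ j, U i j * x j)).trans ?_
          rw [orth_sq hU, hk2]
          apply le_of_eq
          congr 2
          field_simp
      _ = _ := by simp
  rw [Finset.sum_const, ENNReal.ofReal_mul (by positivity)] at h1
  simp only [Finset.card_univ, Fintype.card_pi, Fintype.card_bool, Finset.prod_const, Fintype.card_fin,
    nsmul_eq_mul] at h1
  have e2 : ENNReal.ofReal (2 ^ N) = ((2 ^ N : ℕ) : ENNReal) := by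
    rw [ENNReal.ofReal_pow (by norm_num)]; simp
  rw [e2] at h1
  exact (ENNReal.mul_le_mul_iff_right (by positivity) (ENNReal.natCast_ne_top _)).1 h1

lemma tail_bound {N : ℕ} (hN : 2 ≤ N) (μ : Measure (Fin N → Fin N → ℝ)) [IsProbabilityMeasure μ]
    (horth : ∀ᵐ U ∂μ, IsOrthogonal U)
    (hinv : ∀ V : Fin N → Fin N → ℝ, IsOrthogonal V →
            μ.map (fun U => fun i j => ∑ l, V i l * U l j) = μ)
    (x y : Fin N → ℝ) (hx : ∑ i, x i ^ 2 ≤ 1) (hy : ∑ i, y i ^ 2 ≤ 1) (r : ℝ) (hr : 0 ≤ r) :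
    μ {U | r ≤ QF U y x} ≤ ENNReal.ofReal (Real.exp (- (N * r ^ 2 / 2))) := by
  have hN0 : (0 : ℝ) < N := by positivity
  set L : ℝ := N * r with hL
  have h1 := mgf_bound hN μ horth hinv x (fun i => L * y i)
  have h2 := mul_meas_ge_le_lintegral (μ := μ)
    (f := fun U => ENNReal.ofReal (Real.exp (QF U (fun i => L * y i) x)))
    (ENNReal.measurable_ofReal.comp (Real.measurable_exp.comp (QF_meas _ x)))
    (ENNReal.ofReal (Real.exp (L * r)))
  have hsub : {U | r ≤ QF U y x} ⊆ {U | ENNReal.ofReal (Real.exp (L * r)) ≤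
      ENNReal.ofReal (Real.exp (QF U (fun i => L * y i) x))} := by
    intro U hU
    have hU' : r ≤ QF U y x := hU
    refine ENNReal.ofReal_le_ofReal (Real.exp_le_exp.2 ?_)
    have : QF U (fun i => L * y i) x = L * QF U y x := by
      unfold QF; rw [Finset.mul_sum]; simp only [mul_assoc]
    rw [this]
    exact mul_le_mul_of_nonneg_left hU' (by positivity)
  have h3 : ENNReal.ofReal (Real.exp (L * r)) * μ {U | r ≤ QF U y x} ≤
      ENNReal.ofReal (Real.exp (L ^ 2 / (2 * N))) := by
    refine (mul_le_mul_right (measure_mono hsub) _).trans (h2.trans (h1.trans ?_))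
    refine ENNReal.ofReal_le_ofReal (Real.exp_le_exp.2 ?_)
    simp only [mul_pow, ← Finset.mul_sum]
    gcongr
    have h0 : 0 ≤ ∑ i, x i ^ 2 := by positivity
    have h0' : 0 ≤ ∑ i, y i ^ 2 := by positivity
    have : (∑ i, y i ^ 2) * ∑ i, x i ^ 2 ≤ 1 := mul_le_one₀ hy h0 hx
    have hq : 0 ≤ (N:ℝ)^2 * r^2 := by positivity
    calc _ = (N:ℝ)^2 * r^2 * ((∑ i, y i ^ 2) * ∑ i, x i ^ 2) := by rw [hL]; ring
      _ ≤ _ := by rw [hL, mul_pow]; exact mul_le_of_le_one_right hq this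
  have h4 : ENNReal.ofReal (Real.exp (L ^ 2 / (2 * N))) = ENNReal.ofReal (Real.exp (L * r)) *
      ENNReal.ofReal (Real.exp (- (N * r ^ 2 / 2))) := by
    rw [← ENNReal.ofReal_mul (by positivity), ← Real.exp_add]
    congr 2
    rw [hL]; field_simp; ring
  rw [h4] at h3
  exact (ENNReal.mul_le_mul_iff_right (by positivity) ENNReal.ofReal_ne_top).1 h3

lemma exists_round (t : ℝ) : ∃ k : ℤ, |(k : ℝ)| ≤ |t| ∧ |t - k| ≤ 1 := by
  rcases le_total 0 t with h | h
  · refine ⟨⌊t⌋, ?_, ?_⟩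
    · have : (0 : ℝ) ≤ ⌊t⌋ := by exact_mod_cast Int.floor_nonneg.2 h
      rw [abs_of_nonneg h, abs_of_nonneg this]
      exact Int.floor_le t
    · rw [abs_of_nonneg (by linarith [Int.floor_le t])]
      linarith [Int.lt_floor_add_one t]
  · refine ⟨⌈t⌉, ?_, ?_⟩
    · have : (⌈t⌉ : ℝ) ≤ 0 := by exact_mod_cast Int.ceil_le.2 (by simpa using h)
      rw [abs_of_nonpos h, abs_of_nonpos this]
      linarith [Int.le_ceil t]
    · rw [abs_of_nonpos (by linarith [Int.le_ceil t])]
      linarith [Int.ceil_lt_add_one t]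

/-- integer grid supported on `S` -/
noncomputable def grid (N : ℕ) (S : Finset (Fin N)) : Finset (Fin N → ℤ) :=
  Fintype.piFinset (fun i => if i ∈ S then Finset.Icc (-(N : ℤ)) N else {0})

lemma grid_card (N : ℕ) (S : Finset (Fin N)) : (grid N S).card = (2 * N + 1) ^ S.card := by
  unfold grid
  rw [Fintype.card_piFinset]
  have : ∀ i : Fin N, (if i ∈ S then Finset.Icc (-(N : ℤ)) N else {0}).card =
      if i ∈ S then 2 * N + 1 else 1 := by
    intro i
    split_ifs
    · rw [Int.card_Icc]; omega
    · simp
  simp only [this]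
  rw [Finset.prod_ite_mem]
  simp

lemma exists_grid {N : ℕ} (hN : 2 ≤ N) (S : Finset (Fin N)) (Y : Fin N → ℝ)
    (hS : ∀ i, i ∉ S → Y i = 0) (hY : ∑ i, Y i ^ 2 ≤ 1) :
    ∃ a ∈ grid N S, ∑ i, ((a i : ℝ) / N) ^ 2 ≤ 1 ∧ ∑ i, (Y i - (a i : ℝ) / N) ^ 2 ≤ 1 / N := by
  have hN0 : (0 : ℝ) < N := by positivity
  choose a ha1 ha2 using fun i => exists_round (N * Y i)
  have hle : ∀ i, ((a i : ℝ) / N) ^ 2 ≤ Y i ^ 2 := by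
    intro i
    rw [sq_le_sq, abs_div, abs_of_pos hN0, div_le_iff₀ hN0]
    have := ha1 i
    rw [abs_mul, abs_of_pos hN0] at this
    linarith
  refine ⟨a, ?_, (Finset.sum_le_sum fun i _ => hle i).trans hY, ?_⟩
  · unfold grid
    rw [Fintype.mem_piFinset]
    intro i
    split_ifs with h
    · have h1 : Y i ^ 2 ≤ 1 :=
        (Finset.single_le_sum (f := fun i => Y i ^ 2) (fun i _ => sq_nonneg _) (Finset.mem_univ i)).trans hY
      have h2 : |Y i| ≤ 1 := by
        rwa [sq_le_one_iff_abs_le_one] at h1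
      have h3 : |(a i : ℝ)| ≤ N := by
        have := ha1 i
        rw [abs_mul, abs_of_pos hN0] at this
        nlinarith
      have h4 : |a i| ≤ (N : ℤ) := by exact_mod_cast h3
      rw [Finset.mem_Icc]
      exact abs_le.1 h4
    · have := ha1 i
      rw [hS i h] at this
      simpa using this
  · calc ∑ i, (Y i - (a i : ℝ) / N) ^ 2 ≤ ∑ i : Fin N, (1 / (N : ℝ)) ^ 2 := by
          refine Finset.sum_le_sum fun i _ => ?_
          rw [sq_le_sq]
          have : Y i - (a i : ℝ) / N = (N * Y i - a i) / N := by field_simp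
          rw [this, abs_div, abs_of_pos hN0, abs_of_pos (by positivity : 0 < 1 / (N : ℝ))]
          gcongr
          exact ha2 i
      _ = 1 / N := by
          simp; field_simp

lemma det_bound {N : ℕ} (hN : 2 ≤ N) {U : Fin N → Fin N → ℝ} (hU : IsOrthogonal U)
    (S T : Finset (Fin N)) (hT : T.Nonempty) (r : ℝ) (hr : 0 ≤ r)
    (h : ∀ a ∈ grid N S, ∀ b ∈ grid N T, ∑ i, ((a i : ℝ) / N) ^ 2 ≤ 1 →
      ∑ i, ((b i : ℝ) / N) ^ 2 ≤ 1 →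
      QF U (fun i => (a i : ℝ) / N) (fun i => (b i : ℝ) / N) < r) :
    subOpNorm U S T ≤ r + 2 / √N := by
  classical
  have hN0 : (0 : ℝ) < N := by positivity
  -- bound for unit vectors
  have key : ∀ X Y : Fin N → ℝ, (∀ i, i ∉ T → X i = 0) → (∀ i, i ∉ S → Y i = 0) →
      ∑ i, X i ^ 2 ≤ 1 → ∑ i, Y i ^ 2 ≤ 1 → QF U Y X ≤ r + 2 / √N := by
    intro X Y hXT hYS hX hY
    obtain ⟨a, ha, ha1, ha2⟩ := exists_grid hN S Y hYS hY
    obtain ⟨b, hb, hb1, hb2⟩ := exists_grid hN T X hXT hX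
    have e : QF U Y X = QF U (fun i => (a i : ℝ) / N) (fun i => (b i : ℝ) / N) +
        QF U (fun i => Y i - (a i : ℝ) / N) X +
        QF U (fun i => (a i : ℝ) / N) (fun i => X i - (b i : ℝ) / N) := by
      unfold QF
      simp only [mul_sub, sub_mul, Finset.sum_sub_distrib]
      ring
    have h1 := h a ha b hb ha1 hb1
    have h2 := QF_le hU (fun i => Y i - (a i : ℝ) / N) X
    have h3 := QF_le hU (fun i => (a i : ℝ) / N) (fun i => X i - (b i : ℝ) / N)
    have s1 : √(∑ i, (Y i - (a i : ℝ) / N) ^ 2) ≤ 1 / √N := by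
      rw [← Real.sqrt_one, ← Real.sqrt_div zero_le_one]; exact Real.sqrt_le_sqrt ha2
    have s2 : √(∑ i, (X i - (b i : ℝ) / N) ^ 2) ≤ 1 / √N := by
      rw [← Real.sqrt_one, ← Real.sqrt_div zero_le_one]; exact Real.sqrt_le_sqrt hb2
    have s3 : √(∑ i, X i ^ 2) ≤ 1 := by rw [← Real.sqrt_one]; exact Real.sqrt_le_sqrt hX
    have s4 : √(∑ i, ((a i : ℝ) / N) ^ 2) ≤ 1 := by rw [← Real.sqrt_one]; exact Real.sqrt_le_sqrt ha1
    have m1 := mul_le_mul s1 s3 (Real.sqrt_nonneg _) (by positivity)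
    have m2 := mul_le_mul s4 s2 (Real.sqrt_nonneg _) (by positivity)
    have : 2 / √(N:ℝ) = 1 / √N * 1 + 1 * (1 / √N) := by ring
    rw [e, this]
    linarith
  unfold subOpNorm opNorm
  apply csSup_le
  · obtain ⟨t, ht⟩ := hT
    refine ⟨_, fun _ => 1, ?_, rfl⟩
    intro h0
    have := congrFun h0 ⟨t, ht⟩
    simp at this
  rintro ρ ⟨x, hx0, rfl⟩
  set n : ℝ := √(∑ j, x j ^ 2) with hn
  have hxpos : 0 < ∑ j, x j ^ 2 := by
    obtain ⟨j, hj⟩ := Function.ne_iff.1 hx0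
    refine Finset.sum_pos' (fun i _ => sq_nonneg _) ⟨j, Finset.mem_univ _, ?_⟩
    have : x j ≠ 0 := hj
    positivity
  have hnpos : 0 < n := Real.sqrt_pos.2 hxpos
  have hn2 : n ^ 2 = ∑ j, x j ^ 2 := Real.sq_sqrt hxpos.le
  set m : ℝ := √(∑ i : {a // a ∈ S}, (∑ j : {a // a ∈ T}, U i.val j.val * x j) ^ 2) with hm
  have hm0 : 0 ≤ m := Real.sqrt_nonneg _
  have hm2 : m ^ 2 = ∑ i : {a // a ∈ S}, (∑ j : {a // a ∈ T}, U i.val j.val * x j) ^ 2 :=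
    Real.sq_sqrt (by positivity)
  rcases hm0.eq_or_lt with h0 | hmpos
  · rw [← h0, zero_div]; positivity
  set X : Fin N → ℝ := fun j => if hj : j ∈ T then x ⟨j, hj⟩ / n else 0 with hX
  have sumT : ∀ f : Fin N → ℝ, (∀ j, j ∉ T → f j = 0) → ∑ j, f j = ∑ j : {a // a ∈ T}, f j.val := by
    intro f hf
    rw [Finset.sum_coe_sort T f]
    exact (Finset.sum_subset (Finset.subset_univ T) fun j _ hj => hf j hj).symm
  have sumS : ∀ f : Fin N → ℝ, (∀ j, j ∉ S → f j = 0) → ∑ j, f j = ∑ j : {a // a ∈ S}, f j.val := by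
    intro f hf
    rw [Finset.sum_coe_sort S f]
    exact (Finset.sum_subset (Finset.subset_univ S) fun j _ hj => hf j hj).symm
  have hXT : ∀ j, j ∉ T → X j = 0 := fun j hj => by simp [hX, hj]
  have hXv : ∀ j : {a // a ∈ T}, X j.val = x j / n := fun j => by simp [hX, j.2]
  have hUX : ∀ i, ∑ j, U i j * X j = (∑ j : {a // a ∈ T}, U i j.val * x j) / n := by
    intro i
    rw [sumT _ (fun j hj => by rw [hXT j hj, mul_zero]), Finset.sum_div]
    refine Finset.sum_congr rfl fun j _ => ?_
    rw [hXv]; ring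
  set Y : Fin N → ℝ := fun i => if i ∈ S then (∑ j : {a // a ∈ T}, U i j.val * x j) / m else 0 with hY
  have hYS : ∀ j, j ∉ S → Y j = 0 := fun j hj => by simp [hY, hj]
  have hYv : ∀ i : {a // a ∈ S}, Y i.val = (∑ j : {a // a ∈ T}, U i.val j.val * x j) / m :=
    fun j => by simp [hY, j.2]
  have hX1 : ∑ i, X i ^ 2 ≤ 1 := by
    rw [sumT _ (fun j hj => by rw [hXT j hj]; simp)]
    simp only [hXv, div_pow]
    rw [← Finset.sum_div, ← hn2, div_self (by positivity)]
  have hY1 : ∑ i, Y i ^ 2 ≤ 1 := by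
    rw [sumS _ (fun j hj => by rw [hYS j hj]; simp)]
    simp only [hYv, div_pow]
    rw [← Finset.sum_div, ← hm2, div_self (by positivity)]
  have := key X Y hXT hYS hX1 hY1
  have e : QF U Y X = m / n := by
    unfold QF
    rw [sumS _ (fun j hj => by rw [hYS j hj, zero_mul])]
    simp only [hUX, hYv]
    have : ∀ i : {a // a ∈ S}, (∑ j : {a // a ∈ T}, U i.val j.val * x j) / m *
        ((∑ j : {a // a ∈ T}, U i.val j.val * x j) / n) =
        (∑ j : {a // a ∈ T}, U i.val j.val * x j) ^ 2 / (m * n) := by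
      intro i; field_simp
    simp only [this]
    rw [← Finset.sum_div, ← hm2]
    field_simp
  rwa [e] at this

lemma sum_sets {N : ℕ} (hN : 2 ≤ N) (c : ℝ) (hc0 : 0 ≤ c) (hc : c ≤ 1 / (N : ℝ) ^ 2) :
    ∑ S : Finset (Fin N) with S.Nonempty, c ^ S.card ≤ 3 / N := by
  have hN0 : (0 : ℝ) < N := by positivity
  have h1 : ∀ S : Finset (Fin N), S.Nonempty → c ^ S.card ≤ (1 / N : ℝ) * (1 / N : ℝ) ^ S.card := by
    intro S hS
    have hs : 1 ≤ S.card := hS.card_pos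
    calc c ^ S.card ≤ (1 / (N : ℝ) ^ 2) ^ S.card := pow_le_pow_left₀ hc0 hc _
      _ = (1 / N : ℝ) ^ S.card * (1 / N : ℝ) ^ S.card := by rw [← mul_pow]; congr 1; field_simp
      _ ≤ _ := by
        gcongr
        have hb : (1 / N : ℝ) ≤ 1 := by
          rw [div_le_one hN0]; exact_mod_cast (by omega : 1 ≤ N)
        calc (1 / N : ℝ) ^ S.card ≤ (1 / N : ℝ) ^ 1 := pow_le_pow_of_le_one (by positivity) hb hs
          _ = _ := pow_one _
  calc ∑ S : Finset (Fin N) with S.Nonempty, c ^ S.card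
      ≤ ∑ S : Finset (Fin N) with S.Nonempty, (1 / N : ℝ) * (1 / N : ℝ) ^ S.card :=
        Finset.sum_le_sum fun S hS => h1 S (Finset.mem_filter.1 hS).2
    _ ≤ ∑ S : Finset (Fin N), (1 / N : ℝ) * (1 / N : ℝ) ^ S.card :=
        Finset.sum_le_sum_of_subset_of_nonneg (Finset.filter_subset _ _) fun _ _ _ => by positivity
    _ = (1 / N : ℝ) * (1 / N + 1) ^ N := by
        rw [← Finset.mul_sum]
        congr 1
        have := Fintype.sum_pow_mul_eq_add_pow (Fin N) (1 / N : ℝ) 1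
        simpa using this
    _ ≤ (1 / N : ℝ) * 3 := by
        gcongr
        calc (1 / (N:ℝ) + 1) ^ N ≤ (Real.exp (1 / N)) ^ N := by
              gcongr
              exact Real.add_one_le_exp _
          _ = Real.exp 1 := by rw [← Real.exp_nat_mul]; congr 1; field_simp
          _ ≤ 3 := by linarith [Real.exp_one_lt_d9]
    _ = 3 / N := by ring

lemma thresh {N : ℕ} (hN : 2 ≤ N) (s t : ℕ) (hs : 1 ≤ s) (ht : 1 ≤ t) :
    √(64 * (s + t) * Real.log N / N) + 2 / √N < √(100 * (s + t) * Real.log N / N) := by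
  have hN0 : (0 : ℝ) < N := by positivity
  have hN2 : (2 : ℝ) ≤ N := by exact_mod_cast hN
  have hlog : 0.69 ≤ Real.log N := by
    have := Real.log_le_log (by norm_num) hN2
    linarith [Real.log_two_gt_d9]
  have hs' : (1 : ℝ) ≤ s := by exact_mod_cast hs
  have ht' : (1 : ℝ) ≤ t := by exact_mod_cast ht
  set q : ℝ := (s + t) * Real.log N with hq
  have hq1 : 1.38 ≤ q := by rw [hq]; nlinarith
  have e1 : 64 * (s + t) * Real.log N / N = 8 ^ 2 * q / N := by rw [hq]; ring
  have e2 : 100 * (s + t) * Real.log N / N = 10 ^ 2 * q / N := by rw [hq]; ring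
  have hq0 : 0 ≤ q := by linarith
  clear_value q
  rw [e1, e2, Real.sqrt_div (by positivity), Real.sqrt_div (by positivity),
    Real.sqrt_mul (by positivity), Real.sqrt_mul (by positivity), Real.sqrt_sq (by positivity),
    Real.sqrt_sq (by positivity), ← add_div]
  gcongr
  have : 1 < √q := by rw [Real.lt_sqrt (by norm_num)]; linarith
  linarith

lemma count_le {N : ℕ} (hN : 2 ≤ N) : (2 * N + 1) * (1 / (N : ℝ) ^ 32) ≤ 1 / (N : ℝ) ^ 2 := by
  have hN0 : (0 : ℝ) < N := by positivity
  have hN2 : (2 : ℝ) ≤ N := by exact_mod_cast hN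
  have h30 : 2 * (N : ℝ) + 1 ≤ N ^ 30 := by
    calc 2 * (N : ℝ) + 1 ≤ N ^ 3 := by nlinarith [sq_nonneg ((N:ℝ) - 2)]
      _ ≤ N ^ 30 := pow_le_pow_right₀ (by linarith) (by norm_num)
  calc (2 * N + 1) * (1 / (N : ℝ) ^ 32) ≤ (N : ℝ) ^ 30 * (1 / (N : ℝ) ^ 32) := by gcongr
    _ = 1 / (N : ℝ) ^ 2 := by
      rw [show (N : ℝ) ^ 32 = N ^ 30 * N ^ 2 by rw [← pow_add]]
      field_simp

set_option maxHeartbeats 1000000 in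
/-- most orthogonal matrices are good: there is a universal
constant `C > 0` such that for every `N ≥ 2`, if `μ` is the Haar probability
measure on the orthogonal group `O(N)` (formalized, via its characterizing
properties, as any Borel probability measure on `N × N` real matrices that is
concentrated on orthogonal matrices and invariant under left multiplication by
every orthogonal matrix), then with probability at least `1 - C/N²` over
`U ∼ μ`, every pair of nonempty `S, T ⊆ [N]` satisfies
`‖U_{S,T}‖ < √(100·(|S|+|T|)·ln N / N)`. -/
theorem most_orthogonal_matrices_are_good :
    ∃ C : ℝ, 0 < C ∧
      ∀ (N : ℕ), 2 ≤ N →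
        ∀ μ : Measure (Fin N → Fin N → ℝ), IsProbabilityMeasure μ →
          (∀ᵐ U ∂μ, IsOrthogonal U) →
          (∀ V : Fin N → Fin N → ℝ, IsOrthogonal V →
            μ.map (fun U => fun i j => ∑ l, V i l * U l j) = μ) →
          1 - C / (N : ℝ) ^ 2 ≤
            (μ {U | ∀ S T : Finset (Fin N), S.Nonempty → T.Nonempty →
              subOpNorm U S T <
                Real.sqrt (100 * (S.card + T.card) * Real.log N / N)}).toReal := by
  refine ⟨9, by norm_num, ?_⟩
  intro N hN μ hμ horth hinv
  have hN0 : (0 : ℝ) < N := by positivity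
  have hN2 : (2 : ℝ) ≤ N := by exact_mod_cast hN
  set good := {U : Fin N → Fin N → ℝ | ∀ S T : Finset (Fin N), S.Nonempty → T.Nonempty →
              subOpNorm U S T <
                Real.sqrt (100 * (S.card + T.card) * Real.log N / N)} with hgood
  let F : Finset (Finset (Fin N)) := Finset.univ.filter (fun S => S.Nonempty)
  let r : Finset (Fin N) → Finset (Fin N) → ℝ := fun S T =>
    √(64 * (S.card + T.card) * Real.log N / N)
  let E : Finset (Fin N) → Finset (Fin N) → (Fin N → ℤ) → (Fin N → ℤ) → Set (Fin N → Fin N → ℝ) :=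
    fun S T a b => {U | ∑ i, ((a i : ℝ) / N) ^ 2 ≤ 1 ∧ ∑ i, ((b i : ℝ) / N) ^ 2 ≤ 1 ∧
      r S T ≤ QF U (fun i => (a i : ℝ) / N) (fun i => (b i : ℝ) / N)}
  let p : ℝ := 1 / (N : ℝ) ^ 32
  have hp0 : 0 ≤ p := by positivity
  have hE : ∀ S T a b, μ (E S T a b) ≤ ENNReal.ofReal (p ^ S.card * p ^ T.card) := by
    intro S T a b
    by_cases hab : ∑ i, ((a i : ℝ) / N) ^ 2 ≤ 1 ∧ ∑ i, ((b i : ℝ) / N) ^ 2 ≤ 1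
    · refine (measure_mono (fun U hU => hU.2.2)).trans
        ((tail_bound hN μ horth hinv _ _ hab.2 hab.1 (r S T) (Real.sqrt_nonneg _)).trans ?_)
      refine ENNReal.ofReal_le_ofReal (le_of_eq ?_)
      have hlog : 0 ≤ Real.log N := Real.log_nonneg (by linarith)
      have hr2 : r S T ^ 2 = 64 * (S.card + T.card) * Real.log N / N :=
        Real.sq_sqrt (by positivity)
      have hpe : p = Real.exp (-(32 * Real.log N)) := by
        rw [Real.exp_neg, show (32 : ℝ) * Real.log N = ((32 : ℕ) : ℝ) * Real.log N by norm_num,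
          Real.exp_nat_mul, Real.exp_log hN0]
        simp [p]
      rw [hr2, ← pow_add, hpe, ← Real.exp_nat_mul]
      congr 1
      push_cast
      field_simp
      ring
    · have : E S T a b = ∅ := by
        ext U
        simp only [E, Set.mem_ofPred_eq, Set.mem_empty_iff_false, iff_false]
        exact fun h => hab ⟨h.1, h.2.1⟩
      rw [this]; simp
  have hsub : goodᶜ ⊆ {U | ¬ IsOrthogonal U} ∪
      ⋃ S ∈ F, ⋃ T ∈ F, ⋃ a ∈ grid N S, ⋃ b ∈ grid N T, E S T a b := by
    intro U hU
    by_contra hcon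
    apply hU
    rw [Set.mem_union, not_or] at hcon
    obtain ⟨hUo, hcon⟩ := hcon
    have hUo : IsOrthogonal U := by simpa using hUo
    intro S T hS hT
    refine lt_of_le_of_lt (det_bound hN hUo S T hT (r S T) (Real.sqrt_nonneg _) ?_)
      (thresh hN S.card T.card hS.card_pos hT.card_pos)
    intro a ha b hb ha1 hb1
    by_contra hlt
    apply hcon
    simp only [Set.mem_iUnion]
    exact ⟨S, by simpa [F] using hS, T, by simpa [F] using hT, a, ha, b, hb, ha1, hb1, not_lt.1 hlt⟩
  have hbad : μ goodᶜ ≤ ENNReal.ofReal (9 / (N : ℝ) ^ 2) := by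
    calc μ goodᶜ ≤ μ {U | ¬ IsOrthogonal U} +
          μ (⋃ S ∈ F, ⋃ T ∈ F, ⋃ a ∈ grid N S, ⋃ b ∈ grid N T, E S T a b) :=
          (measure_mono hsub).trans (measure_union_le _ _)
      _ = μ (⋃ S ∈ F, ⋃ T ∈ F, ⋃ a ∈ grid N S, ⋃ b ∈ grid N T, E S T a b) := by
          rw [ae_iff.1 horth, zero_add]
      _ ≤ ∑ S ∈ F, ∑ T ∈ F, ∑ a ∈ grid N S, ∑ b ∈ grid N T, μ (E S T a b) := by
          refine (measure_biUnion_finset_le _ _).trans (Finset.sum_le_sum fun S _ => ?_)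
          refine (measure_biUnion_finset_le _ _).trans (Finset.sum_le_sum fun T _ => ?_)
          refine (measure_biUnion_finset_le _ _).trans (Finset.sum_le_sum fun a _ => ?_)
          exact measure_biUnion_finset_le _ _
      _ ≤ ∑ S ∈ F, ∑ T ∈ F, ∑ a ∈ grid N S, ∑ b ∈ grid N T,
            ENNReal.ofReal (p ^ S.card * p ^ T.card) := by
          refine Finset.sum_le_sum fun S _ => Finset.sum_le_sum fun T _ =>
            Finset.sum_le_sum fun a _ => Finset.sum_le_sum fun b _ => hE S T a b
      _ = ENNReal.ofReal (∑ S ∈ F, ∑ T ∈ F, ∑ a ∈ grid N S, ∑ b ∈ grid N T,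
            (p ^ S.card * p ^ T.card)) := by
          rw [ENNReal.ofReal_sum_of_nonneg (fun _ _ => by positivity)]
          refine Finset.sum_congr rfl fun S _ => ?_
          rw [ENNReal.ofReal_sum_of_nonneg (fun _ _ => by positivity)]
          refine Finset.sum_congr rfl fun T _ => ?_
          rw [ENNReal.ofReal_sum_of_nonneg (fun _ _ => by positivity)]
          refine Finset.sum_congr rfl fun a _ => ?_
          rw [ENNReal.ofReal_sum_of_nonneg (fun _ _ => by positivity)]
      _ ≤ ENNReal.ofReal (9 / (N : ℝ) ^ 2) := by
          refine ENNReal.ofReal_le_ofReal ?_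
          have hc : (2 * N + 1) * p ≤ 1 / (N : ℝ) ^ 2 := count_le hN
          have hss := sum_sets hN ((2 * N + 1) * p) (by positivity) hc
          have e : ∑ S ∈ F, ∑ T ∈ F, ∑ a ∈ grid N S, ∑ b ∈ grid N T,
              (p ^ S.card * p ^ T.card) = (∑ S ∈ F, ((2 * N + 1) * p) ^ S.card) *
                (∑ S ∈ F, ((2 * N + 1) * p) ^ S.card) := by
            rw [Finset.sum_mul_sum]
            refine Finset.sum_congr rfl fun S _ => Finset.sum_congr rfl fun T _ => ?_
            simp only [Finset.sum_const, grid_card, nsmul_eq_mul]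
            push_cast
            rw [mul_pow, mul_pow]
            ring
          rw [e]
          calc _ ≤ (3 / (N : ℝ)) * (3 / N) :=
                mul_le_mul hss hss (Finset.sum_nonneg fun _ _ => by positivity) (by positivity)
            _ = _ := by ring
  have h1 : (1 : ENNReal) ≤ μ good + ENNReal.ofReal (9 / (N : ℝ) ^ 2) := by
    calc (1 : ENNReal) = μ (good ∪ goodᶜ) := by rw [Set.union_compl_self]; simp
      _ ≤ μ good + μ goodᶜ := measure_union_le _ _
      _ ≤ _ := by gcongr
  have h2 := ENNReal.toReal_mono (by finiteness) h1
  rw [ENNReal.toReal_add (by finiteness) (by finiteness), ENNReal.toReal_ofReal (by positivity)] at h2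
  simp only [ENNReal.toReal_one] at h2
  linarith
end
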